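/- There is no polynomial f ∈ ℂ[x,t] with deg_x f = 2 satisfying the generalized bilinear KdV-type equation, i.e., no f of x-degree exactly 2 with 2 f_{xt} f − 2 f_t f_x + 6 (f_{xx})² = 0. -/

import Mathlib

open Polynomial

/-- Formal partial derivative with respect to `t` on `ℂ[t][x]`
(outer variable `x`, inner variable `t`). -/
noncomputable def dt (f : Polynomial (Polynomial ℂ)) : Polynomial (Polynomial ℂ) :=
  f.sum fun n a => Polynomial.C (Polynomial.derivative a) * Polynomial.X ^ n

/-- Formal partial derivative with respect to `x` on `ℂ[t][x]`. -/
noncomputable def dx (f : Polynomial (Polynomial ℂ)) : Polynomial (Polynomial ℂ) :=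
  Polynomial.derivative f

/-- The operator `T f = 2 f_{xt} f − 2 f_t f_x + 6 (f_{xx})²`; the generalized bilinear
KdV-type equation is `T f = 0`. -/
noncomputable def Tkdv (f : Polynomial (Polynomial ℂ)) : Polynomial (Polynomial ℂ) :=
  2 * dx (dt f) * f - 2 * dt f * dx f + 6 * (dx (dx f)) ^ 2

/-- The partial derivative `dt` of a polynomial of `x`-degree at most two. -/
theorem dt_quadratic (a b c : ℂ[X]) :
    dt (C a * X ^ 2 + C b * X + C c) =
      C (derivative a) * X ^ 2 + C (derivative b) * X + C (derivative c) := by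
  have h0 (n : ℕ) : C (derivative (0 : ℂ[X])) * (X : ℂ[X][X]) ^ n = 0 := by simp
  have hadd (n : ℕ) (p q : ℂ[X]) : C (derivative (p + q)) * (X : ℂ[X][X]) ^ n =
      C (derivative p) * X ^ n + C (derivative q) * X ^ n := by
    rw [derivative_add, C_add, add_mul]
  have hmono (n : ℕ) (p : ℂ[X]) : dt (C p * X ^ n) = C (derivative p) * X ^ n := by
    rw [dt, C_mul_X_pow_eq_monomial, sum_monomial_index _ _ (h0 n)]
  have hdt (p q : ℂ[X][X]) : dt (p + q) = dt p + dt q := sum_add_index p q _ h0 hadd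
  have h1 := hmono 1 b
  have h2 := hmono 0 c
  rw [pow_one] at h1
  rw [pow_zero, mul_one, mul_one] at h2
  rw [hdt, hdt, hmono, h1, h2]

/-- The coefficients of a vanishing polynomial of degree at most two vanish. -/
theorem coeffs_eq_zero_of_quadratic_eq_zero {R : Type*} [Semiring R] {a b c : R}
    (h : C a * X ^ 2 + C b * X + C c = 0) : a = 0 ∧ b = 0 ∧ c = 0 := by
  have hcoeff (n : ℕ) := congrArg (fun p => coeff p n) h
  refine ⟨?_, ?_, ?_⟩
  · simpa [coeff_X, coeff_C] using hcoeff 2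
  · simpa [coeff_X, coeff_C, coeff_X_pow] using hcoeff 1
  · simpa using hcoeff 0

/-- The expansion of `Tkdv` in powers of `x` on a polynomial of `x`-degree at most two. -/
theorem Tkdv_quadratic (a b c : ℂ[X]) :
    Tkdv (C a * X ^ 2 + C b * X + C c) =
      C (2 * (derivative a * b - a * derivative b)) * X ^ 2 +
      C (4 * (derivative a * c - a * derivative c)) * X +
      C (2 * (derivative b * c - b * derivative c) + 24 * a ^ 2) := by
  have hdx (p q r : ℂ[X]) : dx (C p * X ^ 2 + C q * X + C r) = C (2 * p) * X + C q := by
    simp only [dx, derivative_add, derivative_C_mul, derivative_X_sq, derivative_X, derivative_C,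
      map_mul, mul_one, add_zero]
    ring
  have hdx' (p q : ℂ[X]) : dx (C p * X + C q) = C p := by simp [dx]
  rw [Tkdv, dt_quadratic, hdx, hdx, hdx']
  simp only [map_mul, map_add, map_sub, map_pow, map_ofNat]
  ring

/-- There is no polynomial solution of the generalized bilinear KdV-type equation of
`x`-degree exactly `2`. -/
theorem no_degree_two_solution :
    ¬ ∃ f : Polynomial (Polynomial ℂ), f.natDegree = 2 ∧ Tkdv f = 0 := by
  rintro ⟨f, hdeg, hT⟩
  have hlead : f.coeff 2 ≠ 0 := by
    rw [← hdeg, coeff_natDegree, leadingCoeff_ne_zero]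
    rintro rfl
    simp at hdeg
  rw [eq_quadratic_of_degree_le_two (natDegree_le_iff_degree_le.mp hdeg.le),
    Tkdv_quadratic] at hT
  obtain ⟨h2, h1, h0⟩ := coeffs_eq_zero_of_quadratic_eq_zero hT
  have hcube : 48 * f.coeff 2 ^ 3 = 0 := by
    linear_combination 2 * f.coeff 2 * h0 + 2 * f.coeff 0 * h2 - f.coeff 1 * h1
  exact hlead (by simpa using hcube)
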